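/- arXiv:1001.3666 — 10 statements merged into one kernel-verified Lean document; each statement's English description precedes it below -/
import Mathlib

section
/- Let A : ℝ → ℝ be monotone nondecreasing. Then for all real numbers u₁, u₂, v₁, v₂ one has (sgn(v₁ − v₂) − sgn(u₁ − u₂)) · ((A(u₁) − A(u₂)) − (v₁ − v₂)) ≤ 0. -/
/-- Quasi-monotonicity of the relaxation term applied to the difference of two
solutions: for `A` monotone nondecreasing,
`(sgn(v₁ - v₂) - sgn(u₁ - u₂)) * ((A u₁ - A u₂) - (v₁ - v₂)) ≤ 0`. -/
theorem quasi_monotonicity_relaxation_difference (A : ℝ → ℝ) (hA : Monotone A)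
    (u₁ u₂ v₁ v₂ : ℝ) :
    (Real.sign (v₁ - v₂) - Real.sign (u₁ - u₂)) * ((A u₁ - A u₂) - (v₁ - v₂)) ≤ 0 := by
  rcases lt_trichotomy u₁ u₂ with hu | hu | hu
  · have ha := hA hu.le
    rw [Real.sign_of_neg (sub_neg.2 hu)]
    rcases lt_trichotomy v₁ v₂ with hv | hv | hv
    · rw [Real.sign_of_neg (sub_neg.2 hv)]; linarith
    · subst hv; rw [sub_self, Real.sign_zero]; linarith
    · rw [Real.sign_of_pos (sub_pos.2 hv)]; linarith
  · subst hu
    rw [sub_self u₁, Real.sign_zero]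
    rcases lt_trichotomy v₁ v₂ with hv | hv | hv
    · rw [Real.sign_of_neg (sub_neg.2 hv)]; linarith
    · subst hv; rw [sub_self v₁, Real.sign_zero]; linarith
    · rw [Real.sign_of_pos (sub_pos.2 hv)]; linarith
  · have ha := hA hu.le
    rw [Real.sign_of_pos (sub_pos.2 hu)]
    rcases lt_trichotomy v₁ v₂ with hv | hv | hv
    · rw [Real.sign_of_neg (sub_neg.2 hv)]; linarith
    · subst hv; rw [sub_self, Real.sign_zero]; linarith
    · rw [Real.sign_of_pos (sub_pos.2 hv)]; linarith
end

section
/- Let h > 0, C > 0, and let B : ℝ → ℝ be a continuous function satisfying (B(a) − B(b))(a − b) ≥ C (a − b)² for all real a, b. Then for every bounded measurable compactly supported v : ℝ → ℝ one has ∫_ℝ (P^h v − v) · B(v) dx ≤ −C ∫_ℝ (P^h v − v)² dx. -/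
open MeasureTheory

/-- The piecewise constant cell-average projection `P^h` on the cells
`C_j = [(j-1/2)h, (j+1/2)h)`, `j ∈ ℤ`: on the cell containing `x`, the value is the
average `(1/h) ∫_{C_j} u`. -/
noncomputable def cellProj (h : ℝ) (u : ℝ → ℝ) : ℝ → ℝ := fun x =>
  (1 / h) * ∫ y in Set.Ico (((⌊x / h + 1 / 2⌋ : ℤ) - 1 / 2 : ℝ) * h)
      (((⌊x / h + 1 / 2⌋ : ℤ) + 1 / 2 : ℝ) * h), u y

theorem aux_integrable (f : ℝ → ℝ) (hf : Measurable f) (K S : ℝ) (hK : ∀ x, |f x| ≤ K)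
    (hS : ∀ x, S < |x| → f x = 0) : Integrable f := by
  have hsub : Function.support f ⊆ Set.Icc (-S) S := by
    intro x hx
    by_contra hn
    apply hx
    apply hS
    by_contra hle
    exact hn (abs_le.mp (not_lt.mp hle))
  rw [← integrableOn_iff_integrable_of_support_subset hsub]
  refine Measure.integrableOn_of_bounded (M := K) (by simp) hf.aestronglyMeasurable ?_
  exact Filter.Eventually.of_forall (fun x => hK x)

theorem aux_cell (h : ℝ) (hh : 0 < h) (x : ℝ) (j : ℤ) :
    x ∈ Set.Ico (((j : ℤ) - 1 / 2 : ℝ) * h) (((j : ℤ) + 1 / 2 : ℝ) * h) ↔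
      ⌊x / h + 1 / 2⌋ = j := by
  rw [Int.floor_eq_iff, Set.mem_Ico, ← le_div_iff₀ hh, ← div_lt_iff₀ hh]
  constructor
  · rintro ⟨h1, h2⟩
    constructor <;> linarith
  · rintro ⟨h1, h2⟩
    constructor <;> linarith

/-- For  continuous with  and  bounded,
measurable, compactly supported:
. -/
theorem integral_proj_sub_mul_coercive (h : ℝ) (hh : 0 < h) (C : ℝ) (hC : 0 < C)
    (B : ℝ → ℝ) (hB : Continuous B)
    (hcoer : ∀ a b : ℝ, (B a - B b) * (a - b) ≥ C * (a - b) ^ 2)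
    (v : ℝ → ℝ) (hmeas : Measurable v) (hbd : ∃ M : ℝ, ∀ x, |v x| ≤ M)
    (hsupp : HasCompactSupport v) :
    ∫ x : ℝ, (cellProj h v x - v x) * B (v x) ≤ -C * ∫ x : ℝ, (cellProj h v x - v x) ^ 2 := by
  obtain ⟨M, hM⟩ := hbd
  have hM0 : 0 ≤ M := (abs_nonneg _).trans (hM 0)
  obtain ⟨R, hR⟩ : ∃ R : ℝ, ∀ x, R < |x| → v x = 0 := by
    obtain ⟨R, hR⟩ := hsupp.isCompact.isBounded.exists_norm_le
    refine ⟨R, fun x hx => ?_⟩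
    by_contra hne
    have := hR x (subset_tsupport v hne)
    rw [Real.norm_eq_abs] at this
    linarith
  have hvi : Integrable v := aux_integrable v hmeas M R hM hR
  have hPmeas : Measurable (cellProj h v) := by
    have : cellProj h v = (fun j : ℤ => (1 / h) * ∫ y in Set.Ico (((j : ℤ) - 1 / 2 : ℝ) * h)
      (((j : ℤ) + 1 / 2 : ℝ) * h), v y) ∘ (fun x : ℝ => ⌊x / h + 1 / 2⌋) := rfl
    rw [this]
    refine (measurable_from_top).comp ?_
    exact Int.measurable_floor.comp (by fun_prop)
  have hvol : ∀ j : ℤ, volume.real (Set.Ico (((j : ℤ) - 1 / 2 : ℝ) * h)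
      (((j : ℤ) + 1 / 2 : ℝ) * h)) = h := by
    intro j
    rw [Real.volume_real_Ico_of_le (by nlinarith)]
    ring
  have hPbd : ∀ x, |cellProj h v x| ≤ M := by
    intro x
    have h1 := norm_setIntegral_le_of_norm_le_const (μ := volume) (f := v) (C := M)
      (s := Set.Ico (((⌊x / h + 1 / 2⌋ : ℤ) - 1 / 2 : ℝ) * h)
      (((⌊x / h + 1 / 2⌋ : ℤ) + 1 / 2 : ℝ) * h)) (by simp) (fun y _ => hM y)
    rw [hvol, Real.norm_eq_abs] at h1
    unfold cellProj
    rw [abs_mul, abs_of_pos (by positivity : 0 < 1 / h), one_div, inv_mul_le_iff₀ hh]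
    linarith
  have hPsupp : ∀ x, R + h < |x| → cellProj h v x = 0 := by
    intro x hx
    unfold cellProj
    rw [setIntegral_eq_zero_of_forall_eq_zero, mul_zero]
    intro y hy
    apply hR
    have hx' := (aux_cell h hh x _).2 rfl
    have h3 : |x - y| ≤ h := by
      rw [abs_le]
      constructor <;> linarith [hx'.1, hx'.2, hy.1, hy.2]
    have h4 := abs_sub_abs_le_abs_sub x y
    linarith
  have hwsupp : ∀ x, R + h < |x| → cellProj h v x - v x = 0 := by
    intro x hx
    rw [hPsupp x hx, hR x (by linarith), sub_zero]
  have hwbd : ∀ x, |cellProj h v x - v x| ≤ 2 * M := by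
    intro x
    have := abs_sub (cellProj h v x) (v x)
    linarith [hPbd x, hM x]
  obtain ⟨K, hK⟩ : ∃ K : ℝ, ∀ u, |u| ≤ M → |B u| ≤ K := by
    obtain ⟨K, hK⟩ := (isCompact_Icc (a := -M) (b := M)).exists_bound_of_continuousOn
      hB.continuousOn
    exact ⟨K, fun u hu => hK u (abs_le.mp hu)⟩
  have key : ∀ g : ℝ → ℝ, Measurable g → ∀ L, (∀ x, |g x| ≤ L) →
      Integrable (fun x => (cellProj h v x - v x) * g x) := by
    intro g hg L hL
    refine aux_integrable _ ((hPmeas.sub hmeas).mul hg) (2 * M * L) (R + h) ?_ ?_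
    · intro x
      rw [abs_mul]
      exact mul_le_mul (hwbd x) (hL x) (abs_nonneg _) (by positivity)
    · intro x hx
      rw [hwsupp x hx, zero_mul]
  have i1 := key (fun x => B (v x)) (hB.measurable.comp hmeas) K (fun x => hK _ (hM x))
  have i2 := key (fun x => B (cellProj h v x)) (hB.measurable.comp hPmeas) K
    (fun x => hK _ (hPbd x))
  have i3 : Integrable (fun x => (cellProj h v x - v x) ^ 2) := by
    have := key (fun x => cellProj h v x - v x) (hPmeas.sub hmeas) _ hwbd
    simpa only [sq] using this
  have hzero : ∫ x, (cellProj h v x - v x) * B (cellProj h v x) = 0 := by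
    have hU : (⋃ j : ℤ, Set.Ico (((j : ℤ) - 1 / 2 : ℝ) * h) (((j : ℤ) + 1 / 2 : ℝ) * h))
        = Set.univ := by
      refine Set.eq_univ_of_forall fun x => Set.mem_iUnion.2 ⟨_, (aux_cell h hh x _).2 rfl⟩
    rw [← setIntegral_univ, ← hU, integral_iUnion (fun j => measurableSet_Ico) ?_
      i2.integrableOn]
    · refine (tsum_congr fun j => ?_).trans tsum_zero
      set c : ℝ := (1 / h) * ∫ y in Set.Ico (((j : ℤ) - 1 / 2 : ℝ) * h)
        (((j : ℤ) + 1 / 2 : ℝ) * h), v y with hc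
      have hcell : ∀ x ∈ Set.Ico (((j : ℤ) - 1 / 2 : ℝ) * h) (((j : ℤ) + 1 / 2 : ℝ) * h),
          (cellProj h v x - v x) * B (cellProj h v x) = (c - v x) * B c := by
        intro x hx
        have : cellProj h v x = c := by
          unfold cellProj
          rw [(aux_cell h hh x j).1 hx]
        rw [this]
      rw [setIntegral_congr_fun measurableSet_Ico hcell, integral_mul_const,
        integral_sub (integrable_const c) hvi.integrableOn, setIntegral_const, hvol, hc,
        smul_eq_mul]
      field_simp
      simp
    · intro i j hij
      refine Set.disjoint_left.2 fun x hx hx' => hij ?_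
      rw [← (aux_cell h hh x i).1 hx, (aux_cell h hh x j).1 hx']
  calc ∫ x : ℝ, (cellProj h v x - v x) * B (v x)
      ≤ ∫ x : ℝ, ((cellProj h v x - v x) * B (cellProj h v x)
          - C * (cellProj h v x - v x) ^ 2) := by
        refine integral_mono i1 (i2.sub (i3.const_mul C)) fun x => ?_
        have := hcoer (cellProj h v x) (v x)
        dsimp only
        linarith
    _ = -C * ∫ x : ℝ, (cellProj h v x - v x) ^ 2 := by
        rw [integral_sub i2 (i3.const_mul C), hzero, integral_const_mul]
        ring
end

section
/- Let h > 0 and let u : ℝ → ℝ be integrable. Then ∫_ℝ sgn(u(x)) · ((P^h u)(x) − u(x)) dx ≤ 0. -/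
open MeasureTheory

lemma mem_cell_iff (h : ℝ) (hh : 0 < h) (j : ℤ) (x : ℝ) :
    x ∈ Set.Ico (((j : ℝ) - 1 / 2) * h) (((j : ℝ) + 1 / 2) * h) ↔ ⌊x / h + 1 / 2⌋ = j := by
  rw [Int.floor_eq_iff, Set.mem_Ico, ← le_div_iff₀ hh, ← div_lt_iff₀ hh]
  constructor <;> rintro ⟨h1, h2⟩ <;> constructor <;> linarith

lemma cell_nonpos (h : ℝ) (hh : 0 < h) (u : ℝ → ℝ) (hu : Integrable u)
    (hF : Integrable (fun x => Real.sign (u x) * (cellProj h u x - u x))) (j : ℤ) :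
    ∫ x in Set.Ico (((j : ℝ) - 1 / 2) * h) (((j : ℝ) + 1 / 2) * h),
      Real.sign (u x) * (cellProj h u x - u x) ≤ 0 := by
  set C := Set.Ico (((j : ℝ) - 1 / 2) * h) (((j : ℝ) + 1 / 2) * h) with hC
  set c : ℝ := (1 / h) * ∫ y in C, u y with hc
  have hvol : volume.real C = h := by
    rw [hC, Real.volume_real_Ico_of_le (by nlinarith)]
    ring
  have hfin : volume C ≠ ⊤ := by rw [hC]; simp
  have hconst : IntegrableOn (fun _ : ℝ => |c|) C := integrableOn_const hfin
  have habs : IntegrableOn (fun x => |u x|) C := hu.abs.integrableOn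
  have h1 : ∫ x in C, Real.sign (u x) * (cellProj h u x - u x) ≤ ∫ x in C, (|c| - |u x|) := by
    refine setIntegral_mono_on hF.integrableOn (hconst.sub habs) measurableSet_Ico ?_
    intro x hx
    have hx' := (mem_cell_iff h hh j x).1 hx
    have hp : cellProj h u x = c := by
      simp only [cellProj, hx', hc, hC]
    rw [hp]
    rcases lt_trichotomy (u x) 0 with hlt | heq | hgt
    · rw [Real.sign_of_neg hlt, abs_of_neg hlt]
      linarith [neg_abs_le c]
    · simp [heq]
    · rw [Real.sign_of_pos hgt, abs_of_pos hgt]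
      linarith [le_abs_self c]
  have h2 : ∫ x in C, (|c| - |u x|) = h * |c| - ∫ x in C, |u x| := by
    rw [integral_sub hconst habs, setIntegral_const, hvol, smul_eq_mul]
  have h3 : h * |c| = |∫ y in C, u y| := by
    rw [hc, abs_mul, abs_of_pos (by positivity : (0 : ℝ) < 1 / h)]
    field_simp
  have h4 : |∫ y in C, u y| ≤ ∫ y in C, |u y| := abs_integral_le_integral_abs
  linarith

/-- For integrable , . -/
theorem integral_sign_mul_proj_sub_nonpos (h : ℝ) (hh : 0 < h) (u : ℝ → ℝ)
    (hu : Integrable u) :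
    ∫ x : ℝ, Real.sign (u x) * (cellProj h u x - u x) ≤ 0 := by
  by_cases hF : Integrable (fun x => Real.sign (u x) * (cellProj h u x - u x))
  · have hU : (⋃ j : ℤ, Set.Ico (((j : ℝ) - 1 / 2) * h) (((j : ℝ) + 1 / 2) * h)) = Set.univ := by
      ext x
      simp only [Set.mem_iUnion, Set.mem_univ, iff_true]
      exact ⟨_, (mem_cell_iff h hh _ x).2 rfl⟩
    rw [← setIntegral_univ, ← hU, integral_iUnion (fun _ => measurableSet_Ico) ?_ hF.integrableOn]
    · exact tsum_nonpos (fun j => cell_nonpos h hh u hu hF j)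
    · intro i j hij
      refine Set.disjoint_left.2 fun x hi hj => hij ?_
      rw [← (mem_cell_iff h hh i x).1 hi, (mem_cell_iff h hh j x).1 hj]
  · rw [integral_undef hF]
end

section
/- Let h > 0 and let w : ℝ → ℝ be integrable. Then ∫_ℝ sgn((P^h w)(x)) · ((P^h w)(x) − w(x)) dx = 0. -/
open MeasureTheory

/-- For integrable  03:21:06 up 2 min,  0 user,  load average: 0.33, 0.09, 0.03
USER     TTY      FROM             LOGIN@   IDLE   JCPU   PCPU WHAT, , since  is
constant on each cell while  has zero average on each cell. -/
theorem integral_sign_proj_mul_proj_sub_eq_zero (h : ℝ) (hh : 0 < h) (w : ℝ → ℝ)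
    (hw : Integrable w) :
    ∫ x : ℝ, Real.sign (cellProj h w x) * (cellProj h w x - w x) = 0 := by
  by_cases hf : Integrable (fun x => Real.sign (cellProj h w x) * (cellProj h w x - w x))
  swap
  · exact integral_undef hf
  let C : ℤ → Set ℝ := fun j => Set.Ico (((j : ℝ) - 1 / 2) * h) (((j : ℝ) + 1 / 2) * h)
  have hC : ∀ j x, x ∈ C j ↔ ⌊x / h + 1 / 2⌋ = j := mem_cell_iff h hh
  have hm : ∀ j, MeasurableSet (C j) := fun j => measurableSet_Ico
  have hd : Pairwise (Function.onFun Disjoint C) := by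
    intro i j hij
    refine Set.disjoint_left.2 fun x hi hj => hij ?_
    rw [← (hC i x).1 hi, (hC j x).1 hj]
  have hU : ⋃ j, C j = Set.univ :=
    Set.eq_univ_of_forall fun x => Set.mem_iUnion.2 ⟨_, (hC _ x).2 rfl⟩
  rw [← setIntegral_univ, ← hU, integral_iUnion hm hd hf.integrableOn]
  have key : ∀ j, ∫ x in C j, Real.sign (cellProj h w x) * (cellProj h w x - w x) = 0 := by
    intro j
    have hval : ∀ x ∈ C j, cellProj h w x = (1 / h) * ∫ y in C j, w y := by
      intro x hx
      unfold cellProj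
      rw [(hC j x).1 hx]
    set c : ℝ := (1 / h) * ∫ y in C j, w y with hc
    have hvol : volume.real (C j) = h := by
      simp only [C]
      rw [Real.volume_real_Ico_of_le (by nlinarith)]
      ring
    have hfin : volume (C j) ≠ ⊤ := by simp [C]
    have hci : Integrable (fun _ : ℝ => c) (volume.restrict (C j)) := integrableOn_const hfin
    rw [setIntegral_congr_fun (g := fun x => Real.sign c * (c - w x)) (hm j)
      (fun x hx => by simp only [hval x hx]), integral_const_mul,
      integral_sub hci hw.integrableOn, setIntegral_const, hvol,
      smul_eq_mul, hc]
    field_simp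
    simp
  simp [key]
end

section
/- Let h > 0 and let u : ℝ → ℝ be integrable with finite total variation TV(u). Then ∫_ℝ |(P^h u)(x) − u(x)| dx ≤ h · TV(u). -/
open MeasureTheory

/-- The cells. -/
def cellC (h : ℝ) (j : ℤ) : Set ℝ := Set.Ico (((j : ℝ) - 1 / 2) * h) (((j : ℝ) + 1 / 2) * h)

lemma mem_cellC {h : ℝ} (hh : 0 < h) (j : ℤ) (x : ℝ) :
    x ∈ cellC h j ↔ ⌊x / h + 1 / 2⌋ = j := by
  rw [Int.floor_eq_iff, cellC, Set.mem_Ico, ← le_div_iff₀ hh, ← div_lt_iff₀ hh]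
  constructor <;> rintro ⟨a, b⟩ <;> constructor <;> linarith

lemma sum_cell_le {h : ℝ} (hh : 0 < h) (u : ℝ → ℝ) (s : Finset ℤ) :
    ∑ j ∈ s, eVariationOn u (cellC h j) ≤ eVariationOn u (⋃ j ∈ s, cellC h j) := by
  induction s using Finset.induction_on_max with
  | empty => simp
  | insert a s ha ih =>
    have hn : a ∉ s := fun hm => lt_irrefl _ (ha a hm)
    rw [Finset.sum_insert hn, Finset.set_biUnion_insert, Set.union_comm, add_comm]
    refine (add_le_add_left ih _).trans (eVariationOn.add_le_union u ?_)
    intro x hx y hy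
    simp only [Set.mem_iUnion] at hx
    obtain ⟨j, hj, hx⟩ := hx
    have h1 : (j : ℝ) + 1 ≤ a := by exact_mod_cast ha j hj
    have h2 := hx.2
    have h3 := hy.1
    nlinarith

lemma cell_pointwise {h : ℝ} (hh : 0 < h) (u : ℝ → ℝ) (hu : Integrable u)
    (hTV : eVariationOn u Set.univ ≠ ⊤) (j : ℤ) (x : ℝ) (hx : x ∈ cellC h j) :
    ‖|cellProj h u x - u x|‖ₑ ≤ eVariationOn u (cellC h j) := by
  have hb : BoundedVariationOn u (cellC h j) :=
    ne_top_of_le_ne_top hTV (eVariationOn.mono u (Set.subset_univ _))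
  have hvol : volume (cellC h j) = ENNReal.ofReal h := by
    rw [cellC, Real.volume_Ico]; congr 1; ring
  have hvolr : volume.real (cellC h j) = h := by
    rw [measureReal_def, hvol, ENNReal.toReal_ofReal hh.le]
  have hP : cellProj h u x = (1 / h) * ∫ y in cellC h j, u y := by
    simp only [cellProj, (mem_cellC hh j x).1 hx, cellC]
  have hE : cellProj h u x - u x = (1 / h) * ∫ y in cellC h j, (u y - u x) := by
    rw [hP, integral_sub hu.integrableOn (integrableOn_const (by simp [hvol])),
      setIntegral_const, hvolr, smul_eq_mul]
    field_simp
  have hB : ‖∫ y in cellC h j, (u y - u x)‖ ≤ (eVariationOn u (cellC h j)).toReal * h := by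
    have := norm_setIntegral_le_of_norm_le_const (μ := volume) (s := cellC h j)
      (f := fun y => u y - u x) (C := (eVariationOn u (cellC h j)).toReal)
      (by simp [hvol]) (fun y hy => by
        rw [← dist_eq_norm]; exact hb.dist_le hy hx)
    rwa [hvolr] at this
  have hF : |cellProj h u x - u x| ≤ (eVariationOn u (cellC h j)).toReal := by
    rw [hE, abs_mul, abs_of_pos (by positivity : 0 < 1 / h), one_div, inv_mul_le_iff₀ hh, mul_comm h]
    exact hB
  rw [Real.enorm_of_nonneg (abs_nonneg _)]
  exact ENNReal.ofReal_le_of_le_toReal hF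

/-- Projection error estimate: for integrable  of finite total variation,
. -/
theorem integral_abs_proj_sub_le (h : ℝ) (hh : 0 < h) (u : ℝ → ℝ) (hu : Integrable u)
    (hTV : eVariationOn u Set.univ ≠ ⊤) :
    ∫ x : ℝ, |cellProj h u x - u x| ≤ h * (eVariationOn u Set.univ).toReal := by
  have hU : (⋃ j : ℤ, cellC h j) = Set.univ := by
    ext x; simp [mem_cellC hh]
  have hm : ∀ j, MeasurableSet (cellC h j) := fun j => measurableSet_Ico
  have hd : Pairwise (Function.onFun Disjoint (cellC h)) := by
    intro i j hij
    refine Set.disjoint_left.2 fun x hi hj => hij ?_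
    rw [mem_cellC hh] at hi hj
    exact hi.symm.trans hj
  have key : ∫⁻ x : ℝ, ‖|cellProj h u x - u x|‖ₑ ≤
      ENNReal.ofReal h * eVariationOn u Set.univ := by
    rw [← setLIntegral_univ, ← hU, lintegral_iUnion hm hd, hU]
    calc ∑' j, ∫⁻ x in cellC h j, ‖|cellProj h u x - u x|‖ₑ
        ≤ ∑' j, ENNReal.ofReal h * eVariationOn u (cellC h j) := by
          refine ENNReal.tsum_le_tsum fun j => ?_
          refine (setLIntegral_mono' (hm j) (fun x hx => cell_pointwise hh u hu hTV j x hx)).trans ?_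
          rw [setLIntegral_const, cellC, Real.volume_Ico, mul_comm]
          apply le_of_eq; congr 2; ring
      _ = ENNReal.ofReal h * ∑' j, eVariationOn u (cellC h j) := ENNReal.tsum_mul_left
      _ ≤ _ := by
          gcongr
          rw [ENNReal.tsum_eq_iSup_sum]
          exact iSup_le fun s => (sum_cell_le hh u s).trans (eVariationOn.mono u (Set.subset_univ _))
  have h1 := (enorm_integral_le_lintegral_enorm (μ := volume)
    (fun x : ℝ => |cellProj h u x - u x|)).trans key
  rw [Real.enorm_of_nonneg (integral_nonneg fun x => abs_nonneg _)] at h1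
  have h2 := (ENNReal.ofReal_le_iff_le_toReal (ENNReal.mul_ne_top ENNReal.ofReal_ne_top hTV)).1 h1
  rwa [ENNReal.toReal_mul, ENNReal.toReal_ofReal hh.le] at h2
end

section
/- Let h > 0, let u : ℝ → ℝ be measurable with finite total variation TV(u), and let φ : ℝ → ℝ be bounded and measurable. Then ∑_{j ∈ ℤ} | (avg_{C_j} u) · (avg_{C_j} φ) − avg_{C_j}(u·φ) | ≤ (sup_ℝ |φ|) · TV(u), where avg_{C_j} f = (1/h)∫_{C_j} f(y) dy. -/
open MeasureTheory

theorem cell_avg_bound (a b h V M : ℝ) (hh : 0 < h) (hab : b - a = h) (u φ : ℝ → ℝ)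
    (hu : Measurable u) (hφ : Measurable φ) (hM : ∀ x, |φ x| ≤ M)
    (hV : ∀ x ∈ Set.Icc a b, ∀ y ∈ Set.Icc a b, |u x - u y| ≤ V) :
    |((1 / h) * ∫ y in Set.Ico a b, u y) * ((1 / h) * ∫ y in Set.Ico a b, φ y) -
      (1 / h) * ∫ y in Set.Ico a b, u y * φ y| ≤ M * V := by
  have hab' : a ≤ b := by linarith
  have haI : a ∈ Set.Icc a b := ⟨le_refl _, hab'⟩
  have hV0 : 0 ≤ V := le_trans (abs_nonneg _) (hV a haI a haI)
  have hM0 : 0 ≤ M := le_trans (abs_nonneg _) (hM a)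
  have hvol : volume (Set.Ico a b) < ⊤ := by simp
  have hvr : volume.real (Set.Ico a b) = h := by
    rw [Real.volume_real_Ico_of_le hab', hab]
  have hub : ∀ x ∈ Set.Ico a b, |u x| ≤ |u a| + V := fun x hx => by
    have h1 := hV x ⟨hx.1, hx.2.le⟩ a haI
    have h2 := abs_add_le (u x - u a) (u a)
    simp only [sub_add_cancel] at h2
    linarith
  have hui : IntegrableOn u (Set.Ico a b) :=
    Measure.integrableOn_of_bounded (M := |u a| + V) hvol.ne hu.aestronglyMeasurable
      ((ae_restrict_iff' measurableSet_Ico).2 (Filter.Eventually.of_forall hub))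
  have hφi : IntegrableOn φ (Set.Ico a b) :=
    Measure.integrableOn_of_bounded (M := M) hvol.ne hφ.aestronglyMeasurable
      (Filter.Eventually.of_forall hM)
  have hupi : IntegrableOn (fun y => u y * φ y) (Set.Ico a b) :=
    Measure.integrableOn_of_bounded (M := (|u a| + V) * M) hvol.ne
      (hu.mul hφ).aestronglyMeasurable
      ((ae_restrict_iff' measurableSet_Ico).2 (Filter.Eventually.of_forall fun x hx => by
        rw [Real.norm_eq_abs, abs_mul]
        exact mul_le_mul (hub x hx) (hM x) (abs_nonneg _) (by positivity)))
  set c : ℝ := (1 / h) * ∫ y in Set.Ico a b, u y with hc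
  have hcx : ∀ x ∈ Set.Ico a b, |c - u x| ≤ V := fun x hx => by
    have e : c - u x = (1 / h) * ∫ y in Set.Ico a b, (u y - u x) := by
      rw [integral_sub hui (integrableOn_const hvol.ne), setIntegral_const, hvr, hc, smul_eq_mul]
      field_simp
    have k := norm_setIntegral_le_of_norm_le_const (f := fun y => u y - u x) (C := V) hvol
      (fun y hy => hV y ⟨hy.1, hy.2.le⟩ x ⟨hx.1, hx.2.le⟩)
    rw [hvr, Real.norm_eq_abs] at k
    rw [e, abs_mul, abs_of_pos (by positivity : 0 < 1 / h), one_div, inv_mul_le_iff₀ hh]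
    linarith
  have e : c * ((1 / h) * ∫ y in Set.Ico a b, φ y) - (1 / h) * ∫ y in Set.Ico a b, u y * φ y
      = (1 / h) * ∫ y in Set.Ico a b, (c * φ y - u y * φ y) := by
    rw [integral_sub (hφi.const_mul c) hupi, integral_const_mul]
    ring
  have k := norm_setIntegral_le_of_norm_le_const (f := fun y => c * φ y - u y * φ y)
    (C := V * M) hvol (fun y hy => by
      rw [← sub_mul, Real.norm_eq_abs, abs_mul]
      exact mul_le_mul (hcx y hy) (hM y) (abs_nonneg _) hV0)
  rw [hvr, Real.norm_eq_abs] at k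
  rw [e, abs_mul, abs_of_pos (by positivity : 0 < 1 / h), one_div, inv_mul_le_iff₀ hh]
  linarith

theorem sum_cell_var_le (h : ℝ) (hh : 0 < h) (u : ℝ → ℝ)
    (hTV : eVariationOn u Set.univ ≠ ⊤) (S : Finset ℤ) :
    ∑ j ∈ S, (eVariationOn u (Set.Icc (((j : ℝ) - 1 / 2) * h) (((j : ℝ) + 1 / 2) * h))).toReal
      ≤ (eVariationOn u Set.univ).toReal := by
  rw [← ENNReal.toReal_sum
    (fun j _ => ne_top_of_le_ne_top hTV (eVariationOn.mono u (Set.subset_univ _)))]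
  refine ENNReal.toReal_mono hTV ?_
  obtain ⟨m, n, hS⟩ : ∃ (m : ℤ) (n : ℕ), S ⊆ (Finset.range n).image (fun i : ℕ => m + (i : ℤ)) := by
    obtain ⟨m, hm⟩ := S.bddBelow
    obtain ⟨p, hp⟩ := S.bddAbove
    refine ⟨m, (p - m + 1).toNat, fun j hj => ?_⟩
    have h1 := hm hj
    have h2 := hp hj
    simp only [Finset.mem_image, Finset.mem_range]
    exact ⟨(j - m).toNat, by omega, by omega⟩
  refine (Finset.sum_le_sum_of_subset hS).trans ?_
  rw [Finset.sum_image (by intro i _ j _ hij; simpa using hij)]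
  have hI : Monotone (fun i : ℕ => ((m : ℝ) + i - 1 / 2) * h) := by
    intro i j hij
    have : (i : ℝ) ≤ j := by exact_mod_cast hij
    simp only
    gcongr
  have := eVariationOn.sum' u hI (n := n)
  refine le_trans (le_of_eq ?_) (this.le.trans (eVariationOn.mono u (Set.subset_univ _)))
  refine Finset.sum_congr rfl fun i _ => ?_
  congr 2 <;> push_cast <;> ring

/-- For `u` measurable of finite total variation and `φ` bounded measurable, with
`avg_{C_j} f = (1/h) ∫_{C_j} f` on the cells `C_j = [(j-1/2)h, (j+1/2)h)`:
`∑_{j ∈ ℤ} |avg_{C_j} u · avg_{C_j} φ − avg_{C_j}(u·φ)| ≤ (sup |φ|) · TV(u)`. -/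
theorem tsum_abs_avg_mul_sub_avg_le (h : ℝ) (hh : 0 < h) (u : ℝ → ℝ) (hu : Measurable u)
    (hTV : eVariationOn u Set.univ ≠ ⊤)
    (φ : ℝ → ℝ) (hφ : Measurable φ) (hφb : ∃ M : ℝ, ∀ x, |φ x| ≤ M) :
    ∑' j : ℤ,
      |((1 / h) * ∫ y in Set.Ico (((j : ℝ) - 1 / 2) * h) (((j : ℝ) + 1 / 2) * h), u y) *
          ((1 / h) * ∫ y in Set.Ico (((j : ℝ) - 1 / 2) * h) (((j : ℝ) + 1 / 2) * h), φ y) -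
        (1 / h) * ∫ y in Set.Ico (((j : ℝ) - 1 / 2) * h) (((j : ℝ) + 1 / 2) * h), u y * φ y| ≤
      (⨆ x : ℝ, |φ x|) * (eVariationOn u Set.univ).toReal := by
  have hbdd : BddAbove (Set.range fun x => |φ x|) := by
    obtain ⟨M, hM⟩ := hφb
    exact ⟨M, by rintro _ ⟨x, rfl⟩; exact hM x⟩
  have hM : ∀ x, |φ x| ≤ ⨆ x : ℝ, |φ x| := fun x => le_ciSup hbdd x
  have hM0 : 0 ≤ ⨆ x : ℝ, |φ x| := le_trans (abs_nonneg _) (hM 0)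
  refine Real.tsum_le_of_sum_le (fun _ => abs_nonneg _) fun S => ?_
  refine le_trans (Finset.sum_le_sum fun j _ => cell_avg_bound _ _ h
    (eVariationOn u (Set.Icc (((j : ℝ) - 1 / 2) * h) (((j : ℝ) + 1 / 2) * h))).toReal _ hh
    (by ring) u φ hu hφ hM fun x hx y hy => ?_) ?_
  · have hb : BoundedVariationOn u (Set.Icc (((j : ℝ) - 1 / 2) * h) (((j : ℝ) + 1 / 2) * h)) :=
      ne_top_of_le_ne_top hTV (eVariationOn.mono u (Set.subset_univ _))
    exact hb.dist_le hx hy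
  · rw [← Finset.mul_sum]
    exact mul_le_mul_of_nonneg_left (sum_cell_var_le h hh u hTV S) hM0
end

section
/- Let λ ≥ 0 and b, k ∈ ℝ, and let ū : ℝ → ℝ be differentiable with ū′(τ) = λ(b − ū(τ)) for all τ. Then |ū(1) − k| − |ū(0) − k| ≤ (1 − e^{−λ}) · (|b − k| − |ū(0) − k|). -/
/-- Along the inner-layer ODE `ū' = λ(b - ū)` with `λ ≥ 0`, for any `k`:
`|ū(1) - k| - |ū(0) - k| ≤ (1 - e^{-λ}) (|b - k| - |ū(0) - k|)`. -/
theorem abs_sub_along_projection_ode (lam : ℝ) (hlam : 0 ≤ lam) (b k : ℝ) (ub : ℝ → ℝ)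
    (hode : ∀ τ : ℝ, HasDerivAt ub (lam * (b - ub τ)) τ) :
    |ub 1 - k| - |ub 0 - k| ≤ (1 - Real.exp (-lam)) * (|b - k| - |ub 0 - k|) := by
  have hd : ∀ τ : ℝ, HasDerivAt (fun t => Real.exp (lam * t) * (ub t - b)) 0 τ := by
    intro τ
    have h1 : HasDerivAt (fun t : ℝ => lam * t) lam τ := by
      simpa using (hasDerivAt_id τ).const_mul lam
    have h2 := h1.exp.mul ((hode τ).sub_const b)
    have h3 : Real.exp (lam * τ) * lam * (ub τ - b)
        + Real.exp (lam * τ) * (lam * (b - ub τ)) = 0 := by ring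
    rw [h3] at h2
    exact h2
  have hc := is_const_of_deriv_eq_zero (fun τ => (hd τ).differentiableAt)
    (fun τ => (hd τ).deriv) 1 0
  simp only [mul_one, mul_zero, Real.exp_zero, one_mul] at hc
  have he : Real.exp (-lam) * Real.exp lam = 1 := by
    rw [← Real.exp_add]; simp
  have hE0 := Real.exp_pos (-lam)
  have hE1 : Real.exp (-lam) ≤ 1 := Real.exp_le_one_iff.mpr (by linarith)
  have hu : ub 1 - k = (1 - Real.exp (-lam)) * (b - k) + Real.exp (-lam) * (ub 0 - k) := by
    linear_combination Real.exp (-lam) * hc - (ub 1 - b) * he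
  have ht := abs_add_le ((1 - Real.exp (-lam)) * (b - k)) (Real.exp (-lam) * (ub 0 - k))
  rw [← hu, abs_mul, abs_mul, abs_of_pos hE0,
    abs_of_nonneg (by linarith : 0 ≤ 1 - Real.exp (-lam))] at ht
  linarith
end

section
/- Let λ ≥ 0 and let A : ℝ → ℝ be differentiable with A′ ≥ 0 everywhere. Suppose ū, v̄ : ℝ → ℝ are differentiable and satisfy ū′(τ) = −λ(A(ū(τ)) − v̄(τ)) and v̄′(τ) = λ(A(ū(τ)) − v̄(τ)) for all τ. Then for all τ ≥ 0, |A(ū(τ)) − v̄(τ)| ≤ e^{−λτ} |A(ū(0)) − v̄(0)|. -/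
/-- Exponential decay of the relaxation defect along the inner-layer relaxation ODE
`ū' = -λ(A(ū) - v̄)`, `v̄' = λ(A(ū) - v̄)` with `A' ≥ 0`:
`|A(ū(τ)) - v̄(τ)| ≤ e^{-λτ} |A(ū(0)) - v̄(0)|` for `τ ≥ 0`. -/
theorem relaxation_defect_exponential_decay (lam : ℝ) (hlam : 0 ≤ lam)
    (A : ℝ → ℝ) (hA : Differentiable ℝ A) (hA' : ∀ x, 0 ≤ deriv A x)
    (ub vb : ℝ → ℝ)
    (hu : ∀ τ : ℝ, HasDerivAt ub (-(lam * (A (ub τ) - vb τ))) τ)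
    (hv : ∀ τ : ℝ, HasDerivAt vb (lam * (A (ub τ) - vb τ)) τ) :
    ∀ τ : ℝ, 0 ≤ τ → |A (ub τ) - vb τ| ≤ Real.exp (-(lam * τ)) * |A (ub 0) - vb 0| := by
  have hd : ∀ t : ℝ, HasDerivAt (fun t => (Real.exp (lam * t) * (A (ub t) - vb t)) ^ 2)
      (-(2 * lam * deriv A (ub t) * (Real.exp (lam * t) * (A (ub t) - vb t)) ^ 2)) t := by
    intro t
    have hg := ((hA (ub t)).hasDerivAt.comp t (hu t)).sub (hv t)
    have he := ((hasDerivAt_id t).const_mul lam).exp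
    have h := (he.mul hg).pow 2
    refine h.congr_deriv ?_
    simp
    ring
  have hanti : Antitone (fun t => (Real.exp (lam * t) * (A (ub t) - vb t)) ^ 2) := by
    refine antitone_of_deriv_nonpos (fun t => (hd t).differentiableAt) (fun t => ?_)
    rw [(hd t).deriv]
    have h1 := hA' (ub t)
    have : 0 ≤ 2 * lam * deriv A (ub t) * (Real.exp (lam * t) * (A (ub t) - vb t)) ^ 2 := by
      positivity
    linarith
  intro τ hτ
  have h := sq_le_sq.mp (hanti hτ)
  rw [abs_mul, abs_mul, Real.abs_exp, Real.abs_exp, mul_zero, Real.exp_zero, one_mul] at h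
  calc |A (ub τ) - vb τ|
      = Real.exp (-(lam * τ)) * (Real.exp (lam * τ) * |A (ub τ) - vb τ|) := by
        rw [← mul_assoc, ← Real.exp_add]; simp
    _ ≤ _ := mul_le_mul_of_nonneg_left h (Real.exp_pos _).le
end

section
/- Let λ ≥ 0 and let A : ℝ → ℝ be monotone nondecreasing and differentiable. Suppose ū, v̄ : ℝ → ℝ are differentiable and satisfy ū′(τ) = −λ(A(ū(τ)) − v̄(τ)) and v̄′(τ) = λ(A(ū(τ)) − v̄(τ)) for all τ. Then for every k ∈ ℝ the function τ ↦ |ū(τ) − k| + |v̄(τ) − A(k)| is nonincreasing on [0, ∞). -/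
/-- Right derivative of the absolute value of a differentiable function. -/
theorem abs_right_deriv_aux (g : ℝ → ℝ) (d x : ℝ) (h : HasDerivAt g d x) :
    HasDerivWithinAt (fun t => |g t|) (if g x = 0 then |d| else SignType.sign (g x) * d)
      (Set.Ici x) x := by
  split_ifs with h0
  · rw [← hasDerivWithinAt_Ioi_iff_Ici, hasDerivWithinAt_iff_tendsto_slope' (by simp)]
    have h1 := h.hasDerivWithinAt (s := Set.Ioi x)
    rw [hasDerivWithinAt_iff_tendsto_slope' (by simp)] at h1
    refine h1.abs.congr' ?_
    filter_upwards [self_mem_nhdsWithin] with z hz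
    have hz' : 0 < z - x := sub_pos.mpr hz
    simp [slope_def_field, h0, abs_div, abs_of_pos hz']
  · exact ((hasDerivAt_abs h0).comp x h).hasDerivWithinAt

/-- Kružkov entropy monotonicity along the inner-layer relaxation ODE
`ū' = -λ(A(ū) - v̄)`, `v̄' = λ(A(ū) - v̄)` with `A` monotone nondecreasing and
differentiable: for every `k`, `τ ↦ |ū(τ) - k| + |v̄(τ) - A(k)|` is nonincreasing
on `[0, ∞)`. -/
theorem entropy_monotone_along_relaxation_ode (lam : ℝ) (hlam : 0 ≤ lam)
    (A : ℝ → ℝ) (hmono : Monotone A) (hA : Differentiable ℝ A)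
    (ub vb : ℝ → ℝ)
    (hu : ∀ τ : ℝ, HasDerivAt ub (-(lam * (A (ub τ) - vb τ))) τ)
    (hv : ∀ τ : ℝ, HasDerivAt vb (lam * (A (ub τ) - vb τ)) τ)
    (k : ℝ) :
    AntitoneOn (fun τ => |ub τ - k| + |vb τ - A k|) (Set.Ici 0) := by
  intro a _ b _ hab
  let F : ℝ → ℝ := fun τ => |ub τ - k| + |vb τ - A k|
  have hcu : Continuous ub := continuous_iff_continuousAt.2 fun t => (hu t).continuousAt
  have hcv : Continuous vb := continuous_iff_continuousAt.2 fun t => (hv t).continuousAt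
  have hF : ContinuousOn F (Set.Icc a b) := by
    apply Continuous.continuousOn
    fun_prop
  refine image_le_of_deriv_right_le_deriv_boundary (f := F) (B := fun _ => F a)
    (B' := fun _ => 0) hF
    (fun x _ => (abs_right_deriv_aux _ _ x ((hu x).sub_const k)).add
      (abs_right_deriv_aux _ _ x ((hv x).sub_const (A k))))
    le_rfl continuousOn_const (fun x _ => hasDerivWithinAt_const _ _ _) ?_
    (Set.right_mem_Icc.2 hab)
  intro x _
  have key : ∀ p q : ℝ, 0 ≤ p → 0 ≤ q → 0 ≤ lam * (p + q) := fun p q hp hq =>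
    mul_nonneg hlam (add_nonneg hp hq)
  rcases lt_trichotomy (ub x - k) 0 with h1 | h1 | h1 <;>
  rcases lt_trichotomy (vb x - A k) 0 with h2 | h2 | h2
  · simp [h1, h2, h1.ne, h2.ne]
  · have hm := hmono (show ub x ≤ k by linarith)
    have := mul_nonneg hlam (show 0 ≤ vb x - A (ub x) by linarith)
    rw [if_neg h1.ne, if_pos h2, abs_of_nonpos (by linarith), sign_neg h1]
    simp
  · have hm := hmono (show ub x ≤ k by linarith)
    have := mul_nonneg hlam (show 0 ≤ vb x - A (ub x) by linarith)
    rw [if_neg h1.ne, if_neg h2.ne', sign_neg h1, sign_pos h2]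
    simp
    linarith
  · have e : ub x = k := by linarith
    have := mul_nonneg hlam (show 0 ≤ A (ub x) - vb x by rw [e]; linarith)
    rw [if_pos h1, if_neg h2.ne, sign_neg h2, abs_of_nonpos (by linarith)]
    simp
  · have e : ub x = k := by linarith
    have e2 : A (ub x) - vb x = 0 := by rw [e]; linarith
    simp [e2]
  · have e : ub x = k := by linarith
    have := mul_nonneg hlam (show 0 ≤ vb x - A (ub x) by rw [e]; linarith)
    rw [if_pos h1, if_neg h2.ne', sign_pos h2, abs_of_nonneg (by linarith)]
    simp
  · have hm := hmono (show k ≤ ub x by linarith)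
    have := mul_nonneg hlam (show 0 ≤ A (ub x) - vb x by linarith)
    rw [if_neg h1.ne', if_neg h2.ne, sign_pos h1, sign_neg h2]
    simp
    linarith
  · have hm := hmono (show k ≤ ub x by linarith)
    have := mul_nonneg hlam (show 0 ≤ A (ub x) - vb x by linarith)
    rw [if_neg h1.ne', if_pos h2, abs_of_nonneg (by linarith), sign_pos h1]
    simp
  · rw [if_neg h1.ne', if_neg h2.ne', sign_pos h1, sign_pos h2]
    simp
end

section
/- Let λ ≥ 0 and let A : ℝ → ℝ be monotone nondecreasing and differentiable. Suppose (ū₁, v̄₁) and (ū₂, v̄₂) are two pairs of differentiable functions ℝ → ℝ each satisfying ū′(τ) = −λ(A(ū(τ)) − v̄(τ)) and v̄′(τ) = λ(A(ū(τ)) − v̄(τ)). Then the function τ ↦ |ū₁(τ) − ū₂(τ)| + |v̄₁(τ) − v̄₂(τ)| is nonincreasing on [0, ∞). -/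
open Set Filter Topology

lemma abs_right_zero {f : ℝ → ℝ} {d x : ℝ} (h : HasDerivAt f d x) (h0 : f x = 0) :
    HasDerivWithinAt (fun t => |f t|) |d| (Ici x) x := by
  rw [← hasDerivWithinAt_Ioi_iff_Ici, hasDerivWithinAt_iff_tendsto_slope' (by simp)]
  have h1 := (hasDerivWithinAt_iff_tendsto_slope' (s := Ioi x) (by simp)).1 h.hasDerivWithinAt
  refine (h1.abs).congr' ?_
  filter_upwards [self_mem_nhdsWithin] with z hz
  have hz' : 0 < z - x := sub_pos.2 hz
  simp [slope_def_field, h0, abs_div, abs_of_pos hz']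

lemma abs_right_pos {f : ℝ → ℝ} {d x : ℝ} (h : HasDerivAt f d x) (h0 : 0 < f x) :
    HasDerivWithinAt (fun t => |f t|) d (Ici x) x := by
  refine (h.congr_of_eventuallyEq ?_).hasDerivWithinAt
  filter_upwards [h.continuousAt.eventually (lt_mem_nhds h0)] with z hz
  exact abs_of_pos hz

lemma abs_right_neg {f : ℝ → ℝ} {d x : ℝ} (h : HasDerivAt f d x) (h0 : f x < 0) :
    HasDerivWithinAt (fun t => |f t|) (-d) (Ici x) x := by
  refine (h.neg.congr_of_eventuallyEq ?_).hasDerivWithinAt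
  filter_upwards [h.continuousAt.eventually (gt_mem_nhds h0)] with z hz
  exact abs_of_neg hz

/-- ODE-level L¹-contraction: for two solutions of the inner-layer relaxation ODE
`ū' = -λ(A(ū) - v̄)`, `v̄' = λ(A(ū) - v̄)` with `A` monotone nondecreasing and
differentiable, `τ ↦ |ū₁(τ) - ū₂(τ)| + |v̄₁(τ) - v̄₂(τ)|` is nonincreasing on `[0, ∞)`. -/
theorem contraction_along_relaxation_ode (lam : ℝ) (hlam : 0 ≤ lam)
    (A : ℝ → ℝ) (hmono : Monotone A) (hA : Differentiable ℝ A)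
    (ub₁ vb₁ ub₂ vb₂ : ℝ → ℝ)
    (hu₁ : ∀ τ : ℝ, HasDerivAt ub₁ (-(lam * (A (ub₁ τ) - vb₁ τ))) τ)
    (hv₁ : ∀ τ : ℝ, HasDerivAt vb₁ (lam * (A (ub₁ τ) - vb₁ τ)) τ)
    (hu₂ : ∀ τ : ℝ, HasDerivAt ub₂ (-(lam * (A (ub₂ τ) - vb₂ τ))) τ)
    (hv₂ : ∀ τ : ℝ, HasDerivAt vb₂ (lam * (A (ub₂ τ) - vb₂ τ)) τ) :
    AntitoneOn (fun τ => |ub₁ τ - ub₂ τ| + |vb₁ τ - vb₂ τ|) (Set.Ici 0) := by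
  have key : ∀ x : ℝ, ∃ D ≤ 0, HasDerivWithinAt
      (fun τ => |ub₁ τ - ub₂ τ| + |vb₁ τ - vb₂ τ|) D (Ici x) x := by
    intro x
    obtain ⟨a, ha⟩ : ∃ a, a = A (ub₁ x) - A (ub₂ x) := ⟨_, rfl⟩
    have hU : HasDerivAt (fun τ => ub₁ τ - ub₂ τ) (-(lam * (a - (vb₁ x - vb₂ x)))) x := by
      refine ((hu₁ x).sub (hu₂ x)).congr_deriv ?_
      rw [ha]; ring
    have hV : HasDerivAt (fun τ => vb₁ τ - vb₂ τ) (lam * (a - (vb₁ x - vb₂ x))) x := by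
      refine ((hv₁ x).sub (hv₂ x)).congr_deriv ?_
      rw [ha]; ring
    rcases lt_trichotomy (ub₁ x - ub₂ x) 0 with h | h | h
    · have ha0 : a ≤ 0 := by have := hmono (sub_neg.1 h).le; linarith
      have h1 := abs_right_neg hU h
      rcases lt_trichotomy (vb₁ x - vb₂ x) 0 with k | k | k
      · exact ⟨_, by linarith, h1.add (abs_right_neg hV k)⟩
      · refine ⟨_, ?_, h1.add (abs_right_zero hV k)⟩
        rw [k, abs_of_nonpos (by nlinarith)]; linarith
      · refine ⟨_, ?_, h1.add (abs_right_pos hV k)⟩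
        nlinarith
    · have ha0 : a = 0 := by rw [ha, sub_eq_zero.1 h, sub_self]
      have h1 := abs_right_zero hU h
      subst ha0
      rcases lt_trichotomy (vb₁ x - vb₂ x) 0 with k | k | k
      · refine ⟨_, ?_, h1.add (abs_right_neg hV k)⟩
        rw [abs_of_nonpos (by nlinarith)]; linarith
      · refine ⟨_, ?_, h1.add (abs_right_zero hV k)⟩
        simp [k]
      · refine ⟨_, ?_, h1.add (abs_right_pos hV k)⟩
        rw [abs_of_nonneg (by nlinarith)]; linarith
    · have ha0 : 0 ≤ a := by have := hmono (sub_pos.1 h).le; linarith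
      have h1 := abs_right_pos hU h
      rcases lt_trichotomy (vb₁ x - vb₂ x) 0 with k | k | k
      · refine ⟨_, ?_, h1.add (abs_right_neg hV k)⟩
        nlinarith
      · refine ⟨_, ?_, h1.add (abs_right_zero hV k)⟩
        rw [k, abs_of_nonneg (by nlinarith)]; linarith
      · exact ⟨_, by linarith, h1.add (abs_right_pos hV k)⟩
  have hc : Continuous (fun τ => |ub₁ τ - ub₂ τ| + |vb₁ τ - vb₂ τ|) := by
    have c1 : Continuous ub₁ := continuous_iff_continuousAt.2 fun x => (hu₁ x).continuousAt
    have c2 : Continuous ub₂ := continuous_iff_continuousAt.2 fun x => (hu₂ x).continuousAt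
    have c3 : Continuous vb₁ := continuous_iff_continuousAt.2 fun x => (hv₁ x).continuousAt
    have c4 : Continuous vb₂ := continuous_iff_continuousAt.2 fun x => (hv₂ x).continuousAt
    fun_prop
  intro s _ t _ hst
  refine image_le_of_liminf_slope_right_le_deriv_boundary (a := s) (b := t) hc.continuousOn
    (B := fun _ => |ub₁ s - ub₂ s| + |vb₁ s - vb₂ s|) (B' := fun _ => 0) le_rfl
    continuousOn_const (fun x _ => hasDerivWithinAt_const _ _ _) ?_ (right_mem_Icc.2 hst)
  intro x _ r hr
  obtain ⟨D, hD, hd⟩ := key x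
  exact hd.liminf_right_slope_le (lt_of_le_of_lt hD hr)
end
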